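/- (Lemma on small eigenvalues.) Let (ℋ, (·,·)_ℋ) be a Hilbert space, 𝒟 ⊆ ℋ a dense subspace, and q : 𝒟 × 𝒟 → ℝ a bilinear form semi-bounded from below with discrete spectrum {ν_i}_{i∈ℕ} and corresponding orthonormal sequence of eigenfunctions {g_i}_{i∈ℕ}. Let F ⊆ 𝒟 be an m-dimensional subspace, and let n ∈ ℕ and γ > 0 be such that: (H1) ν_i ≤ −γ for i ≤ n−1, |ν_i| ≤ γ for i = n,…,n+m−1, and ν_i ≥ γ for i ≥ n+m; (H2) δ := sup{|q(u,v)| : u ∈ 𝒟, v ∈ F, ‖u‖_ℋ = ‖v‖_ℋ = 1} < γ/√2. Then, if {ξ_i}_{i=1,…,m} denotes the set of eigenvalues of q restricted to F, one has |ν_{n+i−1} − ξ_i| ≤ 4δ²/γ for all i = 1,…,m. Moreover, if Π : 𝒟 → span{g_n,…,g_{n+m−1}} denotes the ℋ-orthogonal projection, then ‖v − Πv‖_ℋ / ‖v‖_ℋ ≤ √2 δ/γ for all v ∈ F. -/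

import Mathlib

open RealInnerProductSpace

theorem exists_ne_zero_sum_mul_eq_zero_of_card_lt {ι κ : Type*} {S : Finset ι} {T : Finset κ}
    (hcard : T.card < S.card) (B : κ → ι → ℝ) :
    ∃ c : ι → ℝ, (∃ j ∈ S, c j ≠ 0) ∧ ∀ k ∈ T, ∑ j ∈ S, c j * B k j = 0 := by
  classical
  let L : (S → ℝ) →ₗ[ℝ] (T → ℝ) :=
    LinearMap.pi fun k => ∑ j : S, B k j • LinearMap.proj j
  have hL : LinearMap.ker L ≠ ⊥ :=
    LinearMap.ker_ne_bot_of_finrank_lt (by simpa using hcard)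
  obtain ⟨c, hc, hc0⟩ := Submodule.exists_mem_ne_zero_of_ne_bot hL
  obtain ⟨j, hj⟩ := Function.ne_iff.1 hc0
  refine ⟨fun j => if h : j ∈ S then c ⟨j, h⟩ else 0, ⟨j, j.2, by simpa using hj⟩, fun k hk => ?_⟩
  have := congrFun (LinearMap.mem_ker.1 hc) ⟨k, hk⟩
  rw [← Finset.sum_coe_sort]
  simpa [L, mul_comm] using this

/-- If `q · v` is bounded by `δ ‖v‖`, then `v` is close to the span of the eigenvectors whose
eigenvalues are smaller than `γ` in absolute value. -/
theorem norm_sub_eigenprojection_le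
    {H : Type*} [NormedAddCommGroup H] [InnerProductSpace ℝ H] [CompleteSpace H]
    {D : Submodule ℝ H} {q : D →ₗ[ℝ] D →ₗ[ℝ] ℝ} {ν : ℕ → ℝ}
    {g : ℕ → D} (hg : Orthonormal ℝ fun i => (g i : H))
    (hgcomplete : Dense (Submodule.span ℝ (Set.range fun i => (g i : H)) : Set H))
    (heigen : ∀ (i : ℕ) (u : D), q (g i) u = ν i * ⟪(g i : H), (u : H)⟫)
    {W : Finset ℕ} {γ δ : ℝ} (hγ : 0 < γ) (hW : ∀ i ∉ W, γ ≤ |ν i|) {v : D} (hδ0 : 0 ≤ δ)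
    (hv : ∀ u : D, |q u v| ≤ δ * ‖(u : H)‖ * ‖(v : H)‖) :
    ‖(v : H) - ∑ i ∈ W, ⟪(g i : H), v⟫ • (g i : H)‖ ≤ δ / γ * ‖(v : H)‖ := by
  set a : ℕ → ℝ := fun i => ⟪(g i : H), v⟫ with ha
  set r : H := v - ∑ i ∈ W, a i • (g i : H) with hr
  have hcoef : ∀ i, ⟪(g i : H), r⟫ = if i ∈ W then 0 else a i := by
    intro i
    rw [hr, inner_sub_right]
    split_ifs with hi
    · rw [hg.inner_right_sum a hi, sub_self]
    · rw [inner_sum, Finset.sum_eq_zero, sub_zero]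
      intro j hj
      rw [inner_smul_right, hg.inner_eq_zero (by rintro rfl; exact hi hj), mul_zero]
  have hfin : ∀ S : Finset ℕ, Disjoint S W →
      ∑ i ∈ S, a i ^ 2 ≤ (δ / γ * ‖(v : H)‖) ^ 2 := by
    intro S hS
    let b : ℕ → ℝ := fun i => SignType.sign (ν i) * a i
    let w : D := ∑ i ∈ S, b i • g i
    have hb : ∀ i ∈ S, b i ^ 2 = a i ^ 2 := by
      intro i hi
      have hν : ν i ≠ 0 := by
        intro h
        have := hW i (Finset.disjoint_left.1 hS hi)
        rw [h, abs_zero] at this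
        linarith
      rcases hν.lt_or_gt with h | h <;> simp [b, h]
    have hw : ‖(w : H)‖ ^ 2 = ∑ i ∈ S, a i ^ 2 := by
      rw [← real_inner_self_eq_norm_sq]
      simp only [w, Submodule.coe_sum, Submodule.coe_smul]
      rw [hg.inner_sum]
      refine Finset.sum_congr rfl fun i hi => ?_
      rw [← hb i hi]
      simp [sq]
    have hqw : q w v = ∑ i ∈ S, |ν i| * a i ^ 2 := by
      simp only [w, map_sum, map_smul, LinearMap.sum_apply, LinearMap.smul_apply, heigen,
        smul_eq_mul]
      refine Finset.sum_congr rfl fun i _ => ?_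
      simp only [b, ← sign_mul_self, ha]
      ring
    have hlow : γ * ‖(w : H)‖ ^ 2 ≤ q w v := by
      rw [hw, hqw, Finset.mul_sum]
      exact Finset.sum_le_sum fun i hi =>
        mul_le_mul_of_nonneg_right (hW i (Finset.disjoint_left.1 hS hi)) (sq_nonneg _)
    have hup := (le_abs_self _).trans (hv w)
    rw [← hw]
    refine pow_le_pow_left₀ (norm_nonneg _) ?_ 2
    rcases (norm_nonneg (w : H)).eq_or_lt with h | h
    · rw [← h]; positivity
    · rw [div_mul_eq_mul_div, le_div_iff₀ hγ]
      nlinarith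
  let B : HilbertBasis ℕ ℝ H := HilbertBasis.mk hg
    (top_le_iff.2 (Submodule.dense_iff_topologicalClosure_eq_top.1 hgcomplete))
  have hB : ∀ i, B i = (g i : H) := fun i => by simp [B]
  have hsum := B.hasSum_inner_mul_inner r r
  refine le_of_sq_le_sq ?_ (by positivity)
  rw [← real_inner_self_eq_norm_sq]
  refine hasSum_le_of_sum_le hsum fun S => ?_
  calc ∑ i ∈ S, ⟪r, B i⟫ * ⟪B i, r⟫ = ∑ i ∈ S \ W, a i ^ 2 := by
        rw [Finset.sdiff_eq_filter, Finset.sum_filter]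
        refine Finset.sum_congr rfl fun i _ => ?_
        rw [real_inner_comm, hB, hcoef]
        split_ifs <;> simp_all [sq]
    _ ≤ _ := hfin _ Finset.sdiff_disjoint

theorem sub_le_of_rayleigh_le {ν ξ γ δ V P Q X : ℝ} (hγ : 0 < γ) (hδ0 : 0 ≤ δ)
    (hδγ : δ < γ / √2) (hV : 0 < V) (hR : V - P ≤ (δ / γ) ^ 2 * V)
    (hPV : P ≤ V) (hQX : |Q - X| ≤ δ * (δ / γ) * V) (hξ : |ξ| ≤ δ)
    (hνP : ν * P ≤ X) (hQ : Q ≤ ξ * V) :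
    ν - ξ ≤ 4 * δ ^ 2 / γ := by
  have hs0 : 0 ≤ δ / γ := by positivity
  have hs : δ / γ ≤ 3 / 4 := by
    have h2 : 0 < √2 := by positivity
    rw [lt_div_iff₀ h2] at hδγ
    have h3 : (4 / 3 : ℝ) ≤ √2 := Real.le_sqrt_of_sq_le (by norm_num)
    rw [div_le_iff₀ hγ]
    nlinarith
  have hgoal : 4 * δ ^ 2 / γ = 4 * (δ * (δ / γ)) := by ring
  rw [hgoal]
  generalize δ / γ = s at *
  have hbound : (ν - ξ) * P ≤ δ * s * (1 + s) * V := by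
    have h1 := (abs_le.1 hQX).1
    have h2 : ξ * (V - P) ≤ δ * (s ^ 2 * V) :=
      mul_le_mul ((le_abs_self _).trans hξ) hR (sub_nonneg.2 hPV) hδ0
    linarith
  by_contra! hlt
  have hd : 0 ≤ δ * s := by positivity
  have hP : (1 - s) * (1 + s) * V ≤ P := by linarith
  have h1 : (ν - ξ) * ((1 - s) * (1 + s) * V) ≤ δ * s * (1 + s) * V :=
    (mul_le_mul_of_nonneg_left hP (by linarith)).trans hbound
  have h2 : (ν - ξ) * (1 - s) ≤ δ * s := by
    refine le_of_mul_le_mul_right ?_ (show 0 < (1 + s) * V by positivity)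
    linarith
  nlinarith

/-- A vector `v` in the span of the `e j`, `j ∈ S`, orthogonal to the `g k`, `k ∈ T`, together with
the comparison of the values of `q` at `v` and at its projection to the span of the `g k`,
`k ∈ W`. The coordinates of `v` are `c`, those of its projection are `a`. -/
theorem exists_coords_rayleigh_close
    {H : Type*} [NormedAddCommGroup H] [InnerProductSpace ℝ H] [CompleteSpace H]
    {D : Submodule ℝ H} {q : D →ₗ[ℝ] D →ₗ[ℝ] ℝ} {ν : ℕ → ℝ}
    {g : ℕ → D} (hg : Orthonormal ℝ fun i => (g i : H))
    (hgcomplete : Dense (Submodule.span ℝ (Set.range fun i => (g i : H)) : Set H))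
    (heigen : ∀ (i : ℕ) (u : D), q (g i) u = ν i * ⟪(g i : H), (u : H)⟫)
    {W : Finset ℕ} {γ δ : ℝ} (hγ : 0 < γ) (hW : ∀ i ∉ W, γ ≤ |ν i|) (hδ0 : 0 ≤ δ)
    {ι : Type*} [DecidableEq ι] {e : ι → D} (he : Orthonormal ℝ fun i => (e i : H))
    (hδ : ∀ u, ∀ v ∈ Submodule.span ℝ (Set.range e), |q u v| ≤ δ * ‖(u : H)‖ * ‖(v : H)‖)
    {ξ : ι → ℝ} (hdiag : ∀ i j, q (e i) (e j) = if i = j then ξ i else 0)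
    {S : Finset ι} {T : Finset ℕ} (hcard : T.card < S.card) :
    ∃ (c : ι → ℝ) (a : ℕ → ℝ), 0 < ∑ j ∈ S, c j ^ 2 ∧ (∀ k ∈ T, a k = 0) ∧
      ∑ k ∈ W, a k ^ 2 ≤ ∑ j ∈ S, c j ^ 2 ∧
      ∑ j ∈ S, c j ^ 2 - ∑ k ∈ W, a k ^ 2 ≤ (δ / γ) ^ 2 * ∑ j ∈ S, c j ^ 2 ∧
      |∑ j ∈ S, ξ j * c j ^ 2 - ∑ k ∈ W, ν k * a k ^ 2| ≤ δ * (δ / γ) * ∑ j ∈ S, c j ^ 2 := by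
  obtain ⟨c, ⟨j₀, hj₀, hc⟩, hc0⟩ :=
    exists_ne_zero_sum_mul_eq_zero_of_card_lt hcard fun k j => ⟪(g k : H), (e j : H)⟫
  let v : D := ∑ j ∈ S, c j • e j
  let a : ℕ → ℝ := fun k => ⟪(g k : H), v⟫
  let p : D := ∑ k ∈ W, a k • g k
  have hvF : v ∈ Submodule.span ℝ (Set.range e) :=
    Submodule.sum_mem _ fun j _ => Submodule.smul_mem _ _ (Submodule.subset_span ⟨j, rfl⟩)
  have hpcoe : (p : H) = ∑ k ∈ W, a k • (g k : H) := by simp [p]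
  have hV : ‖(v : H)‖ ^ 2 = ∑ j ∈ S, c j ^ 2 := by
    rw [← real_inner_self_eq_norm_sq]
    simp only [v, Submodule.coe_sum, Submodule.coe_smul]
    rw [he.inner_sum]
    simp [sq]
  have hP : ‖(p : H)‖ ^ 2 = ∑ k ∈ W, a k ^ 2 := by
    rw [← real_inner_self_eq_norm_sq, hpcoe, hg.inner_sum]
    simp [sq]
  have hpv : ⟪(v : H), (p : H)⟫ = ∑ k ∈ W, a k ^ 2 := by
    rw [hpcoe, inner_sum]
    simp only [inner_smul_right, real_inner_comm, a, sq]
  have hQ : q v v = ∑ j ∈ S, ξ j * c j ^ 2 := by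
    simp only [v, map_sum, map_smul, LinearMap.sum_apply, LinearMap.smul_apply, hdiag, smul_eq_mul]
    refine Finset.sum_congr rfl fun i hi => ?_
    simp [hi]
    ring
  have hX : q p v = ∑ k ∈ W, ν k * a k ^ 2 := by
    simp only [p, map_sum, map_smul, LinearMap.sum_apply, LinearMap.smul_apply, heigen,
      smul_eq_mul]
    refine Finset.sum_congr rfl fun i _ => ?_
    simp only [a]
    ring
  have hr : ‖(v : H) - p‖ ^ 2 = ∑ j ∈ S, c j ^ 2 - ∑ k ∈ W, a k ^ 2 := by
    rw [norm_sub_sq_real, hV, hP, hpv]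
    ring
  have hrle : ‖(v : H) - p‖ ≤ δ / γ * ‖(v : H)‖ := by
    rw [hpcoe]
    exact norm_sub_eigenprojection_le hg hgcomplete heigen hγ hW hδ0 fun u => hδ u v hvF
  refine ⟨c, a, ?_, fun k hk => ?_, ?_, ?_, ?_⟩
  · exact Finset.sum_pos' (fun j _ => sq_nonneg _) ⟨j₀, hj₀, by positivity⟩
  · simpa [a, v, inner_sum, inner_smul_right] using hc0 k hk
  · linarith [sq_nonneg ‖(v : H) - p‖]
  · rw [← hr, ← hV, ← mul_pow]
    gcongr
  · rw [← hQ, ← hX, ← hV, ← LinearMap.sub_apply, ← map_sub]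
    calc |q (v - p) v| ≤ δ * ‖(v : H) - p‖ * ‖(v : H)‖ := hδ (v - p) v hvF
      _ ≤ δ * (δ / γ * ‖(v : H)‖) * ‖(v : H)‖ := by gcongr
      _ = δ * (δ / γ) * ‖(v : H)‖ ^ 2 := by ring

/-- **Lemma on small eigenvalues (Colin de Verdière).**
Let `H` be a real Hilbert space, `D ⊆ H` a dense subspace and `q` a bilinear form on
`D`, semi-bounded from below, with discrete spectrum `ν` and corresponding complete
orthonormal sequence of eigenfunctions `g` (i.e. `q (g i) u = ν i ⟪g i, u⟫` for all
`u ∈ D`, with `ν` non-decreasing). Let `F ⊆ D` be an `m`-dimensional subspace, and let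
`n` and `γ > 0` be such that
(H1) `ν i ≤ -γ` for `i < n`, `|ν i| ≤ γ` for `n ≤ i < n + m`, `ν i ≥ γ` for `i ≥ n + m`;
(H2) `|q(u,v)| ≤ δ ‖u‖ ‖v‖` for `u ∈ D`, `v ∈ F`, with `δ < γ/√2`.
If `ξ` enumerates (in matching non-decreasing order, via an `L²`-orthonormal
`q`-diagonalizing basis `e` of `F`) the eigenvalues of `q` restricted to `F`, then
`|ν (n+i) - ξ i| ≤ 4δ²/γ` for all `i`, and the orthogonal projection
`Π v := ∑_{i<m} ⟪g (n+i), v⟫ • g (n+i)` satisfies `‖v - Π v‖ ≤ (√2 δ/γ) ‖v‖` for all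
`v ∈ F`. -/
theorem lemma_on_small_eigenvalues
    {H : Type*} [NormedAddCommGroup H] [InnerProductSpace ℝ H] [CompleteSpace H]
    (D : Submodule ℝ H) (hD : Dense (D : Set H))
    (q : D →ₗ[ℝ] D →ₗ[ℝ] ℝ)
    (hsemibounded : ∃ c : ℝ, ∀ u : D, c * ‖(u : H)‖ ^ 2 ≤ q u u)
    (ν : ℕ → ℝ) (hν : Monotone ν)
    (g : ℕ → D) (hg : Orthonormal ℝ fun i => (g i : H))
    (hgcomplete : Dense (Submodule.span ℝ (Set.range fun i => (g i : H)) : Set H))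
    (heigen : ∀ (i : ℕ) (u : D), q (g i) u = ν i * ⟪(g i : H), (u : H)⟫)
    (m : ℕ) (F : Submodule ℝ H) (hFD : F ≤ D) (hdim : Module.finrank ℝ F = m)
    (n : ℕ) (γ : ℝ) (hγ : 0 < γ)
    (hH1a : ∀ i < n, ν i ≤ -γ)
    (hH1b : ∀ i, n ≤ i → i < n + m → |ν i| ≤ γ)
    (hH1c : ∀ i, n + m ≤ i → γ ≤ ν i)
    (δ : ℝ)
    (hδ : ∀ (u : D) (v : H) (hv : v ∈ F), |q u ⟨v, hFD hv⟩| ≤ δ * ‖(u : H)‖ * ‖v‖)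
    (hδγ : δ < γ / Real.sqrt 2)
    (ξ : Fin m → ℝ) (hξmono : Monotone ξ)
    (e : Fin m → H) (he : Orthonormal ℝ e) (heF : ∀ i, e i ∈ F)
    (hspan : Submodule.span ℝ (Set.range e) = F)
    (hdiag : ∀ i j, q ⟨e i, hFD (heF i)⟩ ⟨e j, hFD (heF j)⟩
      = if i = j then ξ i else 0) :
    (∀ i : Fin m, |ν (n + (i : ℕ)) - ξ i| ≤ 4 * δ ^ 2 / γ) ∧
    ∀ v ∈ F, ‖v - ∑ i ∈ Finset.range m, ⟪(g (n + i) : H), v⟫ • (g (n + i) : H)‖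
      ≤ Real.sqrt 2 * δ / γ * ‖v‖ := by
  have hW : ∀ i ∉ Finset.Ico n (n + m), γ ≤ |ν i| := by
    intro i hi
    rw [Finset.mem_Ico, not_and_or, not_le, not_lt] at hi
    rcases hi with hi | hi
    · exact le_abs.2 (Or.inr (le_neg_of_le_neg (hH1a i hi)))
    · exact le_abs.2 (Or.inl (hH1c i hi))
  constructor
  · intro i
    have hξ : ∀ i, |ξ i| ≤ δ := fun i => by
      simpa [hdiag, he.norm_eq_one] using hδ ⟨e i, hFD (heF i)⟩ (e i) (heF i)
    have hδ0 : 0 ≤ δ := (abs_nonneg _).trans (hξ i)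
    have hclose {S : Finset (Fin m)} {T : Finset ℕ} (hcard : T.card < S.card) :=
      exists_coords_rayleigh_close (e := fun i => ⟨e i, hFD (heF i)⟩) hg hgcomplete heigen hγ hW
        hδ0 he (fun u v hv => hδ u v <|
          (Submodule.span_le (p := F.comap D.subtype)).2
            (by rintro _ ⟨j, rfl⟩; exact heF j) hv) hdiag hcard
    rw [abs_le', neg_sub]
    constructor
    · obtain ⟨c, a, hV, ha, hPV, hR, hQX⟩ :=
        hclose (S := Finset.Iic i) (T := Finset.Ico n (n + i)) (by simp)
      refine sub_le_of_rayleigh_le hγ hδ0 hδγ hV hR hPV hQX (hξ i) ?_ ?_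
      · rw [Finset.mul_sum]
        refine Finset.sum_le_sum fun k hk => ?_
        by_cases hkT : k ∈ Finset.Ico n (n + (i : ℕ))
        · simp [ha k hkT]
        · simp only [Finset.mem_Ico] at hk hkT
          exact mul_le_mul_of_nonneg_right (hν (by lia)) (sq_nonneg _)
      · rw [Finset.mul_sum]
        exact Finset.sum_le_sum fun j hj =>
          mul_le_mul_of_nonneg_right (hξmono (Finset.mem_Iic.1 hj)) (sq_nonneg _)
    · obtain ⟨c, a, hV, ha, hPV, hR, hQX⟩ :=
        hclose (S := Finset.Ici i) (T := Finset.Ico (n + i + 1) (n + m)) (by simp; lia)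
      rw [← neg_sub_neg]
      refine sub_le_of_rayleigh_le
        (Q := -∑ j ∈ Finset.Ici i, ξ j * c j ^ 2)
        (X := -∑ k ∈ Finset.Ico n (n + m), ν k * a k ^ 2)
        hγ hδ0 hδγ hV hR hPV ?_ (by rw [abs_neg]; exact hξ i) ?_ ?_
      · rwa [neg_sub_neg, abs_sub_comm]
      · rw [neg_mul, neg_le_neg_iff, Finset.mul_sum]
        refine Finset.sum_le_sum fun k hk => ?_
        by_cases hkT : k ∈ Finset.Ico (n + (i : ℕ) + 1) (n + m)
        · simp [ha k hkT]
        · simp only [Finset.mem_Ico] at hk hkT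
          exact mul_le_mul_of_nonneg_right (hν (by lia)) (sq_nonneg _)
      · rw [neg_mul, neg_le_neg_iff, Finset.mul_sum]
        exact Finset.sum_le_sum fun j hj =>
          mul_le_mul_of_nonneg_right (hξmono (Finset.mem_Ici.1 hj)) (sq_nonneg _)
  · intro v hv
    rcases eq_or_ne v 0 with rfl | hv0
    · simp
    have hvpos : 0 < ‖v‖ := norm_pos_iff.2 hv0
    have hδ0 : 0 ≤ δ := by
      have := (abs_nonneg _).trans (hδ ⟨v, hFD hv⟩ v hv)
      rw [mul_assoc] at this
      exact nonneg_of_mul_nonneg_left this (by positivity)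
    have h := norm_sub_eigenprojection_le hg hgcomplete heigen hγ hW (v := ⟨v, hFD hv⟩) hδ0
      fun u => hδ u v hv
    rw [Finset.sum_Ico_eq_sum_range, Nat.add_sub_cancel_left] at h
    refine h.trans ?_
    gcongr
    exact le_mul_of_one_le_left hδ0 (Real.one_le_sqrt.2 one_le_two)
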